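/- arXiv:2205.11978 — 2 statements merged into one kernel-verified Lean document; each statement's English description precedes it below -/
import Mathlib

section
/- Suppose there exists a nonprincipal discrete ultrafilter on ℕ. Then no infinite compact Hausdorff βω-space is homogeneous: if X is an infinite compact Hausdorff βω-space, then there exist points x, y ∈ X such that no homeomorphism h : X ≃ₜ X satisfies h y = x. -/
/-- A subset `D` of `X` is C*-embedded if every bounded continuous real-valued function on
`D` extends continuously to `X`. -/
def CStarEmbedded {X : Type*} [TopologicalSpace X] (D : Set X) : Prop :=
  ∀ f : C(↥D, ℝ), (∃ M : ℝ, ∀ d : ↥D, |f d| ≤ M) →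
    ∃ g : C(X, ℝ), ∀ d : ↥D, g ↑d = f d

/-- `X` is a βω-space (van Douwen): every countable discrete subset of `X` with compact
closure is C*-embedded in `X`. -/
def IsBetaOmegaSpace (X : Type*) [TopologicalSpace X] : Prop :=
  ∀ D : Set X, D.Countable → DiscreteTopology ↥D → IsCompact (closure D) →
    CStarEmbedded D

open Set Filter Topology

def Ind {ι : Type} (A : ι → Set ℕ) (I : Set ι) (F : Filter ℕ) : Prop :=
  ∀ s : Finset ι, (↑s : Set ι) ⊆ I → ∀ ε : ι → Prop, ∃ᶠ n in F, ∀ i ∈ s, (n ∈ A i ↔ ε i)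

lemma Ind.mono {ι : Type} {A : ι → Set ℕ} {I I' : Set ι} {F : Filter ℕ}
    (h : Ind A I F) (hI : I' ⊆ I) : Ind A I' F :=
  fun s hs ε => h s (hs.trans hI) ε

lemma Ind.split {ι : Type} {A : ι → Set ℕ} {I : Set ι} {F : Filter ℕ}
    (h : Ind A I F) (Y : Set ℕ) :
    ∃ (J : Finset ι) (Z : Set ℕ), Ind A (I \ ↑J) (F ⊓ 𝓟 Z) ∧ (Z ⊆ Y ∨ Z ⊆ Yᶜ) := by
  classical
  by_cases hY : Ind A I (F ⊓ 𝓟 Y)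
  · exact ⟨∅, Y, by simpa using hY, Or.inl subset_rfl⟩
  · unfold Ind at hY
    push Not at hY
    obtain ⟨s, hs, ε, hε⟩ := hY
    rw [eventually_inf_principal] at hε
    refine ⟨s, {n | ∀ i ∈ s, (n ∈ A i ↔ ε i)} ∩ Yᶜ, ?_, Or.inr inter_subset_right⟩
    intro t ht δ
    rw [frequently_inf_principal]
    have h1 := h (s ∪ t) (by
      rw [Finset.coe_union]
      exact union_subset hs (ht.trans sdiff_subset)) (fun i => if i ∈ s then ε i else δ i)
    refine (h1.and_eventually hε).mono ?_
    rintro n ⟨hn, hn2⟩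
    have hs' : ∀ i ∈ s, (n ∈ A i ↔ ε i) := by
      intro i hi
      simpa [hi] using hn i (Finset.mem_union_left _ hi)
    refine ⟨⟨hs', fun hnY => ?_⟩, ?_⟩
    · obtain ⟨i, hi, h3⟩ := hn2 hnY
      have := hs' i hi
      tauto
    · intro i hi
      have hns : i ∉ s := fun h' => (ht hi).2 h'
      simpa [hns] using hn i (Finset.mem_union_right _ hi)

lemma Ind.add_one {ι : Type} {A : ι → Set ℕ} {I : Set ι} {F : Filter ℕ}
    (h : Ind A I F) {a : ι} (ha : a ∈ I) (b : Prop) :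
    Ind A (I \ {a}) (F ⊓ 𝓟 {n | n ∈ A a ↔ b}) := by
  classical
  intro t ht δ
  rw [frequently_inf_principal]
  have h1 := h (insert a t) (by
    rw [Finset.coe_insert]
    exact insert_subset ha (ht.trans sdiff_subset)) (fun i => if i = a then b else δ i)
  refine h1.mono ?_
  intro n hn
  refine ⟨by simpa using hn a (by simp), fun i hi => ?_⟩
  have : i ≠ a := (ht hi).2
  simpa [this] using hn i (by simp [hi])

lemma step1 {ι : Type} {A : ι → Set ℕ} {I : Set ι} {F G : Filter ℕ}
    (hF : Ind A I F) (hG : Ind A I G) (hI : I.Infinite) (f : ℕ → ℕ) :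
    ∃ (J : Finset ι) (P Q : Set ℕ), Ind A (I \ ↑J) (F ⊓ 𝓟 P) ∧ Ind A (I \ ↑J) (G ⊓ 𝓟 Q) ∧
      ∃ B, P ⊆ f ⁻¹' B ∧ Q ⊆ Bᶜ := by
  classical
  obtain ⟨a, ha⟩ := hI.nonempty
  obtain ⟨J, Z, hZ, hZ'⟩ := hF.split (f ⁻¹' (A a))
  have key : ∀ b : Prop, Ind A (I \ ↑(insert a J)) (G ⊓ 𝓟 {n | n ∈ A a ↔ b}) := fun b =>
    (hG.add_one ha b).mono (by
      intro i hi; simp at hi ⊢; tauto)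
  have hZ2 : Ind A (I \ ↑(insert a J)) (F ⊓ 𝓟 Z) := hZ.mono (by
      intro i hi; simp at hi ⊢; tauto)
  rcases hZ' with h | h
  · exact ⟨insert a J, Z, _, hZ2, key False, A a, h, by intro n hn; simpa using hn⟩
  · exact ⟨insert a J, Z, _, hZ2, key True, (A a)ᶜ, h, by intro n hn; simpa using hn⟩

def Good (f : ℕ → ℕ) (P Q : Set ℕ) : Prop :=
  (∃ B, P ⊆ f ⁻¹' B ∧ Q ⊆ Bᶜ) ∧ (∃ B, Q ⊆ f ⁻¹' B ∧ P ⊆ Bᶜ)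

lemma step2 {ι : Type} {A : ι → Set ℕ} {I : Set ι} {F G : Filter ℕ}
    (hF : Ind A I F) (hG : Ind A I G) (hI : I.Infinite) (f : ℕ → ℕ) :
    ∃ d : Finset ι × Set ℕ × Set ℕ, Ind A (I \ ↑d.1) (F ⊓ 𝓟 d.2.1) ∧
      Ind A (I \ ↑d.1) (G ⊓ 𝓟 d.2.2) ∧ Good f d.2.1 d.2.2 := by
  classical
  obtain ⟨J, P, Q, h1, h2, B, h3, h4⟩ := step1 hF hG hI f
  obtain ⟨J', Q', P', h1', h2', B', h3', h4'⟩ := step1 h2 h1 (hI.sdiff J.finite_toSet) f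
  refine ⟨⟨J ∪ J', P ∩ P', Q ∩ Q'⟩, ?_, ?_, ⟨B, ?_, ?_⟩, ⟨B', ?_, ?_⟩⟩
  · rw [← inf_principal, ← inf_assoc, Finset.coe_union, ← sdiff_sdiff]; exact h2'
  · rw [← inf_principal, ← inf_assoc, Finset.coe_union, ← sdiff_sdiff]; exact h1'
  · exact inter_subset_left.trans h3
  · exact inter_subset_left.trans h4
  · exact inter_subset_right.trans h3'
  · exact inter_subset_right.trans h4'

/-- the independent family -/
lemma exists_ind : ∃ A : (ℕ → Bool) → Set ℕ, Ind A univ ⊤ := by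
  classical
  let K := Σ n : ℕ, Finset (Fin n → Bool)
  obtain ⟨φ⟩ : Nonempty (K ≃ ℕ) := by
    have : Infinite K := Infinite.of_injective (fun n => (⟨n, ∅⟩ : K)) (by
      intro a b h
      exact congrArg Sigma.fst h)
    have := Encodable.ofCountable K
    have := Denumerable.ofEncodableOfInfinite K
    exact ⟨Denumerable.eqv K⟩
  refine ⟨fun x => {m | (fun i : Fin (φ.symm m).1 => x i) ∈ (φ.symm m).2}, ?_⟩
  intro s _ ε
  rw [frequently_top]
  -- choose n separating
  have hsep : ∃ n : ℕ, ∀ x ∈ s, ∀ y ∈ s, (∀ i < n, x i = y i) → x = y := by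
    have : ∀ x y : ℕ → Bool, ∃ n : ℕ, (∀ i < n, x i = y i) → x = y := by
      intro x y
      by_cases h : x = y
      · exact ⟨0, fun _ => h⟩
      · obtain ⟨i, hi⟩ := Function.ne_iff.1 h
        exact ⟨i + 1, fun h' => absurd (h' i (by omega)) hi⟩
    choose N hN using this
    refine ⟨(s ×ˢ s).sup (fun z => N z.1 z.2), fun x hx y hy h => hN x y fun i hi => h i ?_⟩
    exact hi.trans_le (Finset.le_sup (f := fun z : (ℕ → Bool) × (ℕ → Bool) => N z.1 z.2)
      (Finset.mk_mem_product hx hy))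
  obtain ⟨n, hn⟩ := hsep
  refine ⟨φ ⟨n, (s.filter ε).image (fun x (i : Fin n) => x i)⟩, ?_⟩
  intro x hx
  simp only [mem_ofPred_eq]
  rw [Equiv.symm_apply_apply]
  simp only [Finset.mem_image, Finset.mem_filter]
  constructor
  · rintro ⟨y, ⟨hy, hε⟩, h⟩
    rw [hn x hx y hy (fun i hi => (congrFun h ⟨i, hi⟩).symm)]
    exact hε
  · intro h
    exact ⟨x, ⟨hx, h⟩, rfl⟩

lemma limit_ind {ι : Type} {A : ι → Set ℕ} [LinearOrder ι] (h0 : Ind A univ ⊤) (S : Set ι)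
    (hS : ∀ a ∈ S, ∀ b < a, b ∈ S) (J : ι → Finset ι) (P : ι → Set ℕ)
    (h : ∀ a ∈ S, Ind A ({i | ∀ b < a, i ∉ J b} \ ↑(J a)) ((⨅ b ∈ Iio a, 𝓟 (P b)) ⊓ 𝓟 (P a))) :
    Ind A {i | ∀ b ∈ S, i ∉ J b} (⨅ b ∈ S, 𝓟 (P b)) := by
  rcases S.eq_empty_or_nonempty with rfl | hne
  · simpa using h0
  · have e : (⨅ b ∈ S, 𝓟 (P b)) = ⨅ a ∈ S, ((⨅ b ∈ Iio a, 𝓟 (P b)) ⊓ 𝓟 (P a)) := by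
      apply le_antisymm
      · refine le_iInf₂ fun a ha => le_inf (le_iInf₂ fun b hb => iInf₂_le b (hS a ha b hb))
          (iInf₂_le a ha)
      · exact iInf₂_mono fun a ha => inf_le_right
    intro s hs ε hev
    rw [e, Filter.Eventually, mem_biInf_of_directed ?_ hne] at hev
    · obtain ⟨a, ha, hev⟩ := hev
      refine h a ha s (fun i hi => ⟨fun b hb => hs hi b (hS a ha b hb), hs hi a ha⟩) ε hev
    · have mono : ∀ a b, a ≤ b → ((⨅ c ∈ Iio b, 𝓟 (P c)) ⊓ 𝓟 (P b)) ≤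
          ((⨅ c ∈ Iio a, 𝓟 (P c)) ⊓ 𝓟 (P a)) := by
        intro a b hab
        rcases hab.eq_or_lt with rfl | hlt
        · exact le_rfl
        · exact inf_le_left.trans (le_inf (le_iInf₂ fun c hc =>
            iInf₂_le c (mem_Iio.2 (lt_trans (mem_Iio.1 hc) hlt))) (iInf₂_le a (mem_Iio.2 hlt)))
      intro a ha b hb
      rcases le_total a b with h | h
      · exact ⟨b, hb, mono a b h, le_rfl⟩
      · exact ⟨a, ha, le_rfl, mono b a h⟩

lemma exists_incomparable : ∃ p q : Ultrafilter ℕ, ∀ f : ℕ → ℕ, p.map f ≠ q ∧ q.map f ≠ p := by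
  classical
  obtain ⟨A0, hA0⟩ := exists_ind
  let ι := Cardinal.continuum.{0}.ord.ToType
  have hι : Cardinal.mk ι = Cardinal.continuum := by simp [ι]
  obtain ⟨eB⟩ : Nonempty (ι ≃ (ℕ → Bool)) := Cardinal.eq.1 (by rw [hι]; simp)
  obtain ⟨eF⟩ : Nonempty (ι ≃ (ℕ → ℕ)) := Cardinal.eq.1 (by rw [hι]; simp)
  let A : ι → Set ℕ := fun i => A0 (eB i)
  have hA : Ind A univ ⊤ := by
    intro s _ ε
    refine (hA0 (s.map eB.toEmbedding) (subset_univ _) (fun x => ε (eB.symm x))).mono ?_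
    intro n hn i hi
    simpa using hn (eB i) (by simpa using hi)
  -- the infinite remainder
  have hinf : ∀ (a : ι) (J : ι → Finset ι), {i | ∀ b < a, i ∉ J b}.Infinite := by
    intro a J hfin
    have hU : (univ : Set ι) ⊆ {i | ∀ b < a, i ∉ J b} ∪ ⋃ b : Iio a, (↑(J b) : Set ι) := by
      intro i _
      by_cases h : ∀ b < a, i ∉ J b
      · exact Or.inl h
      · push Not at h
        obtain ⟨b, hb, h⟩ := h
        exact Or.inr (mem_iUnion.2 ⟨⟨b, hb⟩, h⟩)
    have h1 := Cardinal.mk_le_mk_of_subset hU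
    rw [Cardinal.mk_univ, hι] at h1
    have h2 : Cardinal.mk (⋃ b : Iio a, (↑(J b) : Set ι) : Set ι) < Cardinal.continuum := by
      refine (Cardinal.mk_iUnion_le _).trans_lt ?_
      refine Cardinal.mul_lt_of_lt Cardinal.aleph0_le_continuum ?_ ?_
      · exact Cardinal.mk_Iio_toType_ord_lt a
      · refine lt_of_le_of_lt ?_ Cardinal.aleph0_lt_continuum
        exact ciSup_le' fun b => ((J b).finite_toSet.lt_aleph0).le
    have h3 : Cardinal.mk {i | ∀ b < a, i ∉ J b} < Cardinal.continuum :=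
      hfin.lt_aleph0.trans Cardinal.aleph0_lt_continuum
    exact absurd (h1.trans (Cardinal.mk_union_le _ _))
      (not_le.2 (Cardinal.add_lt_of_lt Cardinal.aleph0_le_continuum h3 h2))
  let D := Finset ι × Set ℕ × Set ℕ
  -- recursion
  have hrec : ∃ g : ι → D, ∀ a,
      Ind A {i | ∀ b < a, i ∉ (g b).1} (⨅ b ∈ Iio a, 𝓟 (g b).2.1) →
      Ind A {i | ∀ b < a, i ∉ (g b).1} (⨅ b ∈ Iio a, 𝓟 (g b).2.2) →
      (Ind A ({i | ∀ b < a, i ∉ (g b).1} \ ↑(g a).1) ((⨅ b ∈ Iio a, 𝓟 (g b).2.1) ⊓ 𝓟 (g a).2.1) ∧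
      Ind A ({i | ∀ b < a, i ∉ (g b).1} \ ↑(g a).1) ((⨅ b ∈ Iio a, 𝓟 (g b).2.2) ⊓ 𝓟 (g a).2.2) ∧
      Good (eF a) (g a).2.1 (g a).2.2) := by
    have hstep : ∀ (a : ι) (g : ι → D), ∃ d : D,
      Ind A {i | ∀ b < a, i ∉ (g b).1} (⨅ b ∈ Iio a, 𝓟 (g b).2.1) →
      Ind A {i | ∀ b < a, i ∉ (g b).1} (⨅ b ∈ Iio a, 𝓟 (g b).2.2) →
      (Ind A ({i | ∀ b < a, i ∉ (g b).1} \ ↑d.1) ((⨅ b ∈ Iio a, 𝓟 (g b).2.1) ⊓ 𝓟 d.2.1) ∧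
      Ind A ({i | ∀ b < a, i ∉ (g b).1} \ ↑d.1) ((⨅ b ∈ Iio a, 𝓟 (g b).2.2) ⊓ 𝓟 d.2.2) ∧
      Good (eF a) d.2.1 d.2.2) := by
      intro a g
      by_cases h1 : Ind A {i | ∀ b < a, i ∉ (g b).1} (⨅ b ∈ Iio a, 𝓟 (g b).2.1)
      · by_cases h2 : Ind A {i | ∀ b < a, i ∉ (g b).1} (⨅ b ∈ Iio a, 𝓟 (g b).2.2)
        · obtain ⟨d, hd⟩ := step2 h1 h2 (hinf a (fun b => (g b).1)) (eF a)
          exact ⟨d, fun _ _ => hd⟩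
        · exact ⟨(∅, ∅, ∅), fun _ h => absurd h h2⟩
      · exact ⟨(∅, ∅, ∅), fun h => absurd h h1⟩
    choose st hst using hstep
    have wf : WellFounded ((· < ·) : ι → ι → Prop) := wellFounded_lt
    let g : ι → D := wf.fix (fun a ih => st a (fun b => if h : b < a then ih b h else (∅, ∅, ∅)))
    have hg : ∀ a, g a = st a (fun b => if b < a then g b else (∅, ∅, ∅)) := by
      intro a
      have := wf.fix_eq
        (fun a (ih : ∀ b, b < a → D) => st a (fun b => if h : b < a then ih b h else (∅, ∅, ∅))) a
      simpa [g] using this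
    refine ⟨g, fun a => ?_⟩
    have h := hst a (fun b => if b < a then g b else (∅, ∅, ∅))
    rw [← hg a] at h
    have e1 : {i | ∀ b < a, i ∉ (if b < a then g b else (∅, ∅, ∅) : D).1} =
        {i | ∀ b < a, i ∉ (g b).1} := by
      ext i
      refine forall₂_congr fun b hb => ?_
      rw [if_pos hb]
    have e2 : (⨅ b ∈ Iio a, 𝓟 (if b < a then g b else (∅, ∅, ∅) : D).2.1) =
        (⨅ b ∈ Iio a, 𝓟 (g b).2.1) := iInf_congr fun b => iInf_congr fun hb => by
      rw [if_pos (mem_Iio.1 hb)]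
    have e3 : (⨅ b ∈ Iio a, 𝓟 (if b < a then g b else (∅, ∅, ∅) : D).2.2) =
        (⨅ b ∈ Iio a, 𝓟 (g b).2.2) := iInf_congr fun b => iInf_congr fun hb => by
      rw [if_pos (mem_Iio.1 hb)]
    rw [e1, e2, e3] at h
    exact h
  obtain ⟨g, hg⟩ := hrec
  have hinv : ∀ a, Ind A {i | ∀ b < a, i ∉ (g b).1} (⨅ b ∈ Iio a, 𝓟 (g b).2.1) ∧
      Ind A {i | ∀ b < a, i ∉ (g b).1} (⨅ b ∈ Iio a, 𝓟 (g b).2.2) := by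
    intro a
    induction a using WellFoundedLT.induction with
    | ind a ih =>
      exact ⟨limit_ind hA (Iio a) (fun c hc b hb => lt_trans hb hc) (fun b => (g b).1)
          (fun b => (g b).2.1) (fun c hc => (hg c (ih c hc).1 (ih c hc).2).1),
        limit_ind hA (Iio a) (fun c hc b hb => lt_trans hb hc) (fun b => (g b).1)
          (fun b => (g b).2.2) (fun c hc => (hg c (ih c hc).1 (ih c hc).2).2.1)⟩
  have hp := limit_ind hA univ (fun c hc b hb => mem_univ _) (fun b => (g b).1)
          (fun b => (g b).2.1) (fun c hc => (hg c (hinv c).1 (hinv c).2).1)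
  have hq := limit_ind hA univ (fun c hc b hb => mem_univ _) (fun b => (g b).1)
          (fun b => (g b).2.2) (fun c hc => (hg c (hinv c).1 (hinv c).2).2.1)
  have nb : ∀ {I : Set ι} {F : Filter ℕ}, Ind A I F → F.NeBot := fun {I F} h =>
    ⟨fun hb => by
      have h1 := h ∅ (by simp) (fun _ => True)
      rw [hb] at h1
      exact h1 (by simp)⟩
  have := nb hp
  have := nb hq
  refine ⟨Ultrafilter.of (⨅ b ∈ (univ : Set ι), 𝓟 (g b).2.1),
    Ultrafilter.of (⨅ b ∈ (univ : Set ι), 𝓟 (g b).2.2), ?_⟩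
  intro f
  obtain ⟨a, rfl⟩ := eF.surjective f
  obtain ⟨⟨B, h1, h2⟩, ⟨B', h3, h4⟩⟩ := (hg a (hinv a).1 (hinv a).2).2.2
  have hP : (g a).2.1 ∈ Ultrafilter.of (⨅ b ∈ (univ : Set ι), 𝓟 (g b).2.1) :=
    Ultrafilter.of_le _ ((iInf₂_le a (mem_univ a) : _ ≤ 𝓟 (g a).2.1) (mem_principal_self _))
  have hQ : (g a).2.2 ∈ Ultrafilter.of (⨅ b ∈ (univ : Set ι), 𝓟 (g b).2.2) :=
    Ultrafilter.of_le _ ((iInf₂_le a (mem_univ a) : _ ≤ 𝓟 (g a).2.2) (mem_principal_self _))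
  constructor
  · intro h
    have h5 : B ∈ Ultrafilter.of (⨅ b ∈ (univ : Set ι), 𝓟 (g b).2.2) := by
      rw [← h, Ultrafilter.mem_map]; exact mem_of_superset hP h1
    exact Ultrafilter.compl_notMem_iff.2 h5 (mem_of_superset hQ h2)
  · intro h
    have h5 : B' ∈ Ultrafilter.of (⨅ b ∈ (univ : Set ι), 𝓟 (g b).2.1) := by
      rw [← h, Ultrafilter.mem_map]; exact mem_of_superset hQ h3
    exact Ultrafilter.compl_notMem_iff.2 h5 (mem_of_superset hP h4)


lemma sep_of_betaOmega {X : Type*} [TopologicalSpace X] [CompactSpace X]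
    (hX : IsBetaOmegaSpace X) {D A B : Set X} (hc : D.Countable) (hd : DiscreteTopology ↥D)
    (hA : A ⊆ D) (hB : B ⊆ D) (hAB : Disjoint A B) : Disjoint (closure A) (closure B) := by
  classical
  let f : C(↥D, ℝ) := ⟨fun x => if (x : X) ∈ A then 1 else 0, continuous_of_discreteTopology⟩
  obtain ⟨g, hg⟩ := hX D hc hd isClosed_closure.isCompact f ⟨1, fun d => by
    by_cases h : (d : X) ∈ A <;> simp [f, h]⟩
  have h1 : closure A ⊆ g ⁻¹' {1} := closure_minimal (fun x hx => by
    have := hg ⟨x, hA hx⟩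
    simpa [f, hx] using this) (isClosed_singleton.preimage g.continuous)
  have h0 : closure B ⊆ g ⁻¹' {0} := closure_minimal (fun x hx => by
    have := hg ⟨x, hB hx⟩
    have hx' : x ∉ A := fun h => hAB.ne_of_mem h hx rfl
    simpa [f, hx'] using this) (isClosed_singleton.preimage g.continuous)
  rw [Set.disjoint_left]
  intro x hx hx'
  have a : g x = 1 := h1 hx
  have b : g x = 0 := h0 hx'
  rw [a] at b
  exact one_ne_zero b

lemma discrete_of_nhds {X : Type*} [TopologicalSpace X] {D : Set X}
    (h : ∀ x ∈ D, ∃ U, IsOpen U ∧ x ∈ U ∧ ∀ y ∈ D, y ∈ U → y = x) : DiscreteTopology ↥D := by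
  rw [discreteTopology_iff_isOpen_singleton]
  rintro ⟨x, hx⟩
  obtain ⟨U, hU, hxU, hy⟩ := h x hx
  refine ⟨U, hU, ?_⟩
  ext ⟨y, hyD⟩
  simp only [mem_preimage, mem_singleton_iff, Subtype.mk.injEq]
  exact ⟨fun h => hy y hyD h, fun h => h ▸ hxU⟩

lemma mem_unique {X : Type*} {d : ℕ → X} {U : ℕ → Set X} (hdU : ∀ n, d n ∈ U n)
    (hdis : Pairwise (Function.onFun Disjoint U)) {m n : ℕ} (h : d m ∈ U n) : m = n := by
  by_contra hne
  exact (hdis hne).ne_of_mem (hdU m) h rfl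

lemma case_closure {X : Type*} [TopologicalSpace X] [CompactSpace X]
    (hX : IsBetaOmegaSpace X) (d e : ℕ → X) (U V : ℕ → Set X)
    (hU : ∀ n, IsOpen (U n)) (hV : ∀ n, IsOpen (V n)) (hdU : ∀ n, d n ∈ U n)
    (heV : ∀ n, e n ∈ V n) (hUd : Pairwise (Function.onFun Disjoint U))
    (hVd : Pairwise (Function.onFun Disjoint V)) (p q : Ultrafilter ℕ) (x : X)
    (hp : Tendsto d p (𝓝 x)) (hq : Tendsto e q (𝓝 x))
    (hcl : ∀ᶠ n in (q : Filter ℕ), e n ∈ closure (range d)) :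
    ∃ f : ℕ → ℕ, p.map f = q := by
  classical
  let f : ℕ → ℕ := fun m => if h : ∃ n, d m ∈ V n then h.choose else 0
  have hf : ∀ m n, d m ∈ V n → f m = n := by
    intro m n h
    have hex : ∃ n, d m ∈ V n := ⟨n, h⟩
    have h2 : d m ∈ V (f m) := by
      simp only [f, dif_pos hex]; exact hex.choose_spec
    by_contra hne
    exact (hVd hne).ne_of_mem h2 h rfl
  have hdisc : DiscreteTopology ↥(range d) := discrete_of_nhds (by
    rintro _ ⟨n, rfl⟩
    refine ⟨U n, hU n, hdU n, ?_⟩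
    rintro _ ⟨m, rfl⟩ h
    rw [mem_unique hdU hUd h])
  refine ⟨f, Ultrafilter.coe_le_coe.1 ?_⟩
  intro B hB
  by_contra hB'
  have hC : {m | f m ∉ B} ∈ p := by
    exact (Ultrafilter.compl_mem_iff_notMem (f := p.map f)).2 hB'
  have hsep := sep_of_betaOmega hX (countable_range d) hdisc
    (A := d '' {m | f m ∉ B}) (B := d '' {m | ∃ n ∈ B, d m ∈ V n})
    (image_subset_range _ _) (image_subset_range _ _) (by
      rw [Set.disjoint_left]
      rintro _ ⟨m, hm, rfl⟩ ⟨m', ⟨n, hn, hm'⟩, h⟩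
      have := mem_unique hdU hUd (h ▸ hdU m' : d m ∈ U m')
      subst this
      exact hm (by rw [hf m n hm']; exact hn))
  refine hsep.ne_of_mem (a := x) (b := x) ?_ ?_ rfl
  · exact mem_closure_of_tendsto hp (mem_of_superset hC fun m hm => mem_image_of_mem d hm)
  · rw [← closure_closure]
    refine mem_closure_of_tendsto hq ?_
    filter_upwards [hcl, hB] with n hn hnB
    rw [mem_closure_iff]
    intro W hW hnW
    obtain ⟨_, ⟨h1, h2⟩, m, rfl⟩ := mem_closure_iff.1 hn (W ∩ V n) (hW.inter (hV n)) ⟨hnW, heV n⟩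
    exact ⟨d m, h1, m, ⟨n, hnB, h2⟩, rfl⟩

lemma comparable_of_lim {X : Type*} [TopologicalSpace X] [CompactSpace X]
    (hX : IsBetaOmegaSpace X) (d e : ℕ → X) (U V : ℕ → Set X)
    (hU : ∀ n, IsOpen (U n)) (hV : ∀ n, IsOpen (V n)) (hdU : ∀ n, d n ∈ U n)
    (heV : ∀ n, e n ∈ V n) (hUd : Pairwise (Function.onFun Disjoint U))
    (hVd : Pairwise (Function.onFun Disjoint V)) (p q : Ultrafilter ℕ) (x : X)
    (hp : Tendsto d p (𝓝 x)) (hq : Tendsto e q (𝓝 x)) :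
    (∃ f : ℕ → ℕ, p.map f = q) ∨ ∃ f : ℕ → ℕ, q.map f = p := by
  by_cases h1 : ∀ᶠ n in (q : Filter ℕ), e n ∈ closure (range d)
  · exact Or.inl (case_closure hX d e U V hU hV hdU heV hUd hVd p q x hp hq h1)
  by_cases h2 : ∀ᶠ n in (p : Filter ℕ), d n ∈ closure (range e)
  · exact Or.inr (case_closure hX e d V U hV hU heV hdU hVd hUd q p x hq hp h2)
  exfalso
  rw [← Ultrafilter.eventually_not] at h1 h2
  let D1 := d '' {n | d n ∉ closure (range e)}
  let E1 := e '' {n | e n ∉ closure (range d)}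
  have hdisc : DiscreteTopology ↥(D1 ∪ E1) := discrete_of_nhds (by
    rintro _ (⟨n, hn, rfl⟩ | ⟨n, hn, rfl⟩)
    · refine ⟨U n ∩ (closure (range e))ᶜ, (hU n).inter isClosed_closure.isOpen_compl,
        ⟨hdU n, hn⟩, ?_⟩
      rintro _ (⟨m, hm, rfl⟩ | ⟨m, hm, rfl⟩) ⟨h, h'⟩
      · rw [mem_unique hdU hUd h]
      · exact absurd (subset_closure (mem_range_self m)) h'
    · refine ⟨V n ∩ (closure (range d))ᶜ, (hV n).inter isClosed_closure.isOpen_compl,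
        ⟨heV n, hn⟩, ?_⟩
      rintro _ (⟨m, hm, rfl⟩ | ⟨m, hm, rfl⟩) ⟨h, h'⟩
      · exact absurd (subset_closure (mem_range_self m)) h'
      · rw [mem_unique heV hVd h])
  have hsep := sep_of_betaOmega hX (((to_countable _).image d).union ((to_countable _).image e))
    hdisc (A := D1) (B := E1) subset_union_left subset_union_right (by
      rw [Set.disjoint_left]
      rintro _ ⟨m, hm, rfl⟩ ⟨m', hm', h⟩
      exact hm (h ▸ subset_closure (mem_range_self m')))
  refine hsep.ne_of_mem (a := x) (b := x) ?_ ?_ rfl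
  · exact mem_closure_of_tendsto hp (h2.mono fun m hm => mem_image_of_mem d hm)
  · exact mem_closure_of_tendsto hq (h1.mono fun m hm => mem_image_of_mem e hm)

/-- If there is a nonprincipal discrete ultrafilter on `ℕ`, then no infinite
compact Hausdorff βω-space is homogeneous: there are points `x`, `y` such that no
self-homeomorphism takes `y` to `x`. -/
theorem no_homogeneous_compact_betaOmega
    (hUF : ∃ p : Ultrafilter ℕ, (∀ n : ℕ, p ≠ pure n) ∧
      ∀ f : ℕ → ℝ, ∃ A ∈ p, DiscreteTopology ↥(f '' A))
    (X : Type*) [TopologicalSpace X] [CompactSpace X] [T2Space X] [Infinite X]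
    (hX : IsBetaOmegaSpace X) :
    ∃ x y : X, ∀ h : X ≃ₜ X, h y ≠ x := by
  obtain ⟨p, q, hpq⟩ := exists_incomparable
  obtain ⟨U, hUi, hUo, hUd⟩ := exists_seq_infinite_isOpen_pairwise_disjoint X
  choose d hd using fun n => (hUi n).nonempty
  have lim : ∀ r : Ultrafilter ℕ, ∃ x, Tendsto d r (𝓝 x) := fun r => by
    obtain ⟨x, -, hx⟩ := isCompact_univ.ultrafilter_le_nhds (r.map d) (by simp)
    exact ⟨x, hx⟩
  obtain ⟨x, hx⟩ := lim p
  obtain ⟨y, hy⟩ := lim q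
  refine ⟨x, y, fun h hxy => ?_⟩
  have hy' : Tendsto (h ∘ d) q (𝓝 x) := by
    rw [← hxy]; exact (h.continuous.tendsto y).comp hy
  rcases comparable_of_lim hX d (h ∘ d) U (fun n => h '' U n) hUo
    (fun n => h.isOpenMap _ (hUo n)) hd (fun n => mem_image_of_mem h (hd n)) hUd
    (fun m n hmn => disjoint_image_of_injective h.injective (hUd hmn)) p q x hx hy' with
    ⟨f, hf⟩ | ⟨f, hf⟩
  · exact (hpq f).1 hf
  · exact (hpq f).2 hf
end

section
/- No product of infinite compact Hausdorff R₂-spaces is homogeneous: if ι is a nonempty index type and for each i ∈ ι, X_i is an infinite compact Hausdorff R₂-space, then the product space ∏_{i ∈ ι} X_i is not homogeneous. -/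
/-- `X` is an R₂-space: any two separated countable subsets of `X`, at least one of which
is discrete, have disjoint closures. -/
def IsR2Space (X : Type*) [TopologicalSpace X] : Prop :=
  ∀ A B : Set X, A.Countable → B.Countable → DiscreteTopology ↥A →
    closure A ∩ B = ∅ → A ∩ closure B = ∅ → closure A ∩ closure B = ∅

/-- A space is homogeneous if any point can be taken to any other point by a
self-homeomorphism. -/
def IsHomogeneousSpace (X : Type*) [TopologicalSpace X] : Prop :=
  ∀ x y : X, ∃ h : X ≃ₜ X, h y = x

namespace R2Prod
open Set Filter Topology Cardinal

abbrev Row := ℕ → Bool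

/-- The countable index set carrying Kunen's independent linked matrix. -/
abbrev SS := Σ k : ℕ, ((Fin k → Bool) → Finset (Fin k → Bool))

def tr (k : ℕ) (X : Row) : Fin k → Bool := fun i => X i

/-- The matrix. -/
def LL (X Y : Row) (n : ℕ) : Set SS :=
  {s | (s.2 (tr s.1 X)).card ≤ n ∧ tr s.1 Y ∈ s.2 (tr s.1 X)}

lemma LL_mono (X Y : Row) {m n : ℕ} (h : m ≤ n) : LL X Y m ⊆ LL X Y n :=
  fun _ hs => ⟨hs.1.trans h, hs.2⟩

lemma tr_inj (b : Finset Row) : ∀ᶠ k in atTop, Set.InjOn (tr k) (b : Set Row) := by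
  have : ∀ᶠ k in atTop, ∀ x ∈ b, ∀ y ∈ b, tr k x = tr k y → x = y := by
    rw [eventually_all_finset]
    intro x _
    rw [eventually_all_finset]
    intro y _
    by_cases hxy : x = y
    · exact Eventually.of_forall fun _ _ => hxy
    · obtain ⟨m, hm⟩ := Function.ne_iff.mp hxy
      filter_upwards [eventually_gt_atTop m] with k hk h
      exact absurd (congrFun h ⟨m, hk⟩) hm
  filter_upwards [this] with k hk x hx y hy h
  exact hk x hx y hy h

lemma LL_linked (X : Row) (b : Finset Row) (n : ℕ) (hn : n < b.card) :
    {s : SS | ∀ β ∈ b, s ∈ LL X β n}.Finite := by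
  obtain ⟨K, hK⟩ := eventually_atTop.mp (tr_inj b)
  have hfin : (⋃ k ∈ Set.Iio K, Set.range
      (fun f : ((Fin k → Bool) → Finset (Fin k → Bool)) => (⟨k, f⟩ : SS))).Finite :=
    (Set.finite_Iio K).biUnion fun k _ => Set.finite_range _
  refine hfin.subset ?_
  rintro ⟨k, f⟩ hs
  simp only [Set.mem_ofPred_eq] at hs
  by_cases hk : k < K
  · simp only [Set.mem_iUnion]
    exact ⟨k, hk, f, rfl⟩
  · exfalso
    have h1 : b.image (tr k) ⊆ f (tr k X) := by
      intro u hu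
      obtain ⟨β, hβ, rfl⟩ := Finset.mem_image.mp hu
      exact (hs β hβ).2
    have h2 := Finset.card_le_card h1
    rw [Finset.card_image_of_injOn (hK k (not_lt.mp hk))] at h2
    have hb : b.Nonempty := Finset.card_pos.mp (by omega)
    obtain ⟨β, hβ⟩ := hb
    have h3 : (f (tr k X)).card ≤ n := (hs β hβ).1
    omega

/-- Patterns. -/
def PP (a : Finset Row) (b : Row → Finset Row) : Set SS :=
  {s | ∀ i ∈ a, ∀ β ∈ b i, s ∈ LL i β (b i).card}

lemma PP_infinite (a : Finset Row) (b : Row → Finset Row) : (PP a b).Infinite := by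
  intro hfin
  obtain ⟨K, hK⟩ := eventually_atTop.mp (tr_inj a)
  have h1 := hfin.image Sigma.fst
  refine (Set.Ici_infinite K) (h1.subset ?_)
  intro k hk
  refine ⟨⟨k, fun u => (a.filter (fun i => tr k i = u)).biUnion
    (fun i => (b i).image (tr k))⟩, ?_, rfl⟩
  intro i hi β hβ
  have hf : a.filter (fun j => tr k j = tr k i) = {i} := by
    ext j
    simp only [Finset.mem_filter, Finset.mem_singleton]
    constructor
    · rintro ⟨hj, h⟩
      exact hK k hk hj hi h
    · rintro rfl
      exact ⟨hi, rfl⟩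
  simp only [LL, Set.mem_ofPred_eq, hf, Finset.singleton_biUnion]
  exact ⟨Finset.card_image_le, Finset.mem_image_of_mem _ hβ⟩

def Good (F : Filter SS) (R : Set Row) : Prop :=
  ∀ (a : Finset Row) (b : Row → Finset Row), Disjoint (a : Set Row) R → (F ⊓ 𝓟 (PP a b)).NeBot

lemma good_cofinite : Good cofinite ∅ := fun a b _ =>
  cofinite_inf_principal_neBot_iff.mpr (PP_infinite a b)

open Classical in
lemma PP_union {a a' : Finset Row} (b b' : Row → Finset Row) (h : Disjoint a' a) :
    PP (a ∪ a') (fun i => if i ∈ a then b i else b' i) ⊆ PP a b ∩ PP a' b' := by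
  intro s hs
  constructor
  · intro i hi β hβ
    have := hs i (Finset.mem_union_left _ hi) β
    simp only [hi, if_true] at this
    exact this hβ
  · intro i hi β hβ
    have := hs i (Finset.mem_union_right _ hi) β
    have hn : i ∉ a := Finset.disjoint_left.mp h hi
    simp only [hn, if_false] at this
    exact this hβ

lemma good_inf {F : Filter SS} {R : Set Row} (h : Good F R) (a : Finset Row)
    (b : Row → Finset Row) (ha : Disjoint (a : Set Row) R) :
    Good (F ⊓ 𝓟 (PP a b)) (R ∪ a) := by
  classical
  intro a' b' ha'
  rw [Set.disjoint_union_right] at ha'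
  have h1 : Disjoint a' a := by exact_mod_cast ha'.2
  have := h (a ∪ a') (fun i => if i ∈ a then b i else b' i) (by
    rw [Finset.coe_union, Set.disjoint_union_left]; exact ⟨ha, ha'.1⟩)
  refine this.mono ?_
  rw [inf_assoc, inf_principal]
  exact inf_le_inf_left _ (principal_mono.mpr (PP_union b b' h1))

def TaskA (C : ℕ → Set SS) (F : Filter SS) : Prop :=
  (∃ n, (C n)ᶜ ∈ F) ∨ ∃ V : Row → Set SS, (∀ β, V β ∈ F) ∧
    ∀ (b : Finset Row) (k : ℕ), b.Nonempty → k ≤ b.card → ((⋂ β ∈ b, V β) \ C k).Finite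

def TaskB (r : Ultrafilter SS) (F : Filter SS) : Prop :=
  (r : Filter SS) ≤ cofinite → ∃ A ∈ F, A ∉ r

lemma TaskA.mono {C} {F G : Filter SS} (h : TaskA C F) (hG : G ≤ F) : TaskA C G := by
  rcases h with ⟨n, h⟩ | ⟨V, h, h'⟩
  · exact Or.inl ⟨n, hG h⟩
  · exact Or.inr ⟨V, fun β => hG (h β), h'⟩

lemma TaskB.mono {C} {F G : Filter SS} (h : TaskB C F) (hG : G ≤ F) : TaskB C G := by
  intro hr
  obtain ⟨A, hA, hA'⟩ := h hr
  exact ⟨A, hG hA, hA'⟩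

lemma stepA {F : Filter SS} {R : Set Row} (h : Good F R) (hR : ∃ i, i ∉ R)
    (C : ℕ → Set SS) (hC : Antitone C) :
    ∃ (F' : Filter SS) (U : Finset Row), F' ≤ F ∧ Good F' (R ∪ U) ∧ TaskA C F' := by
  classical
  by_cases hc : ∃ n a b, Disjoint ((a : Finset Row) : Set Row) R ∧ ¬ (F ⊓ 𝓟 (PP a b ∩ C n)).NeBot
  · obtain ⟨n, a, b, ha, hb⟩ := hc
    refine ⟨F ⊓ 𝓟 (PP a b), a, inf_le_left, good_inf h a b ha, Or.inl ⟨n, ?_⟩⟩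
    rw [not_neBot, ← inf_principal, ← inf_assoc, inf_principal_eq_bot] at hb
    exact hb
  · push Not at hc
    obtain ⟨i, hi⟩ := hR
    let V : Row → Set SS := fun β =>
      {x | x ∈ C 0 ∧ ∀ n, x ∈ C n → x ∉ C (n+1) → x ∈ LL i β n}
    have key : ∀ (t : Finset Row), (∀ x ∈ C t.card, (∀ β ∈ t, x ∈ LL i β t.card) →
        x ∈ ⋂ β ∈ t, V β) := by
      intro t x hx hL
      simp only [Set.mem_iInter]
      intro β hβ
      refine ⟨hC (Nat.zero_le _) hx, fun n _ hn' => ?_⟩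
      have : t.card ≤ n := by
        by_contra hlt
        exact hn' (hC (by omega) hx)
      exact LL_mono _ _ this (hL β hβ)
    refine ⟨F ⊓ ⨅ β, 𝓟 (V β), {i}, inf_le_left, ?_, Or.inr ⟨V, ?_, ?_⟩⟩
    · intro a b hab
      rw [Set.disjoint_union_right] at hab
      have hia : i ∉ a := by
        have := hab.2
        simpa using this
      rw [neBot_iff]
      intro hbot
      rw [inf_right_comm, ← empty_mem_iff_bot, mem_inf_iff] at hbot
      obtain ⟨A, hA, B, hB, hAB⟩ := hbot
      rw [mem_iInf_finite] at hB
      obtain ⟨t, ht⟩ := hB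
      rw [iInf_principal_finset, mem_principal] at ht
      have hn := hc t.card (insert i a) (Function.update b i t) (by
        rw [Finset.coe_insert, Set.disjoint_insert_left]; exact ⟨hi, hab.1⟩)
      have hsub : PP (insert i a) (Function.update b i t) ∩ C t.card ⊆
          PP a b ∩ ⋂ β ∈ t, V β := by
        rintro x ⟨hx, hxC⟩
        constructor
        · intro j hj β hβ
          have hji : j ≠ i := fun e => hia (e ▸ hj)
          have := hx j (Finset.mem_insert_of_mem hj) β
          rw [Function.update_of_ne hji] at this
          exact this hβ
        · apply key t x hxC
          have := hx i (Finset.mem_insert_self _ _)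
          rwa [Function.update_self] at this
      have hle : F ⊓ 𝓟 (PP (insert i a) (Function.update b i t) ∩ C t.card) ≤
          (F ⊓ 𝓟 (PP a b)) ⊓ 𝓟 (⋂ β ∈ t, V β) := by
        rw [inf_assoc, inf_principal]
        exact inf_le_inf_left _ (principal_mono.mpr hsub)
      have h2 := hn.mono hle
      have h3 : (∅ : Set SS) ∈ (F ⊓ 𝓟 (PP a b)) ⊓ 𝓟 (⋂ β ∈ t, V β) := by
        rw [hAB]
        exact inter_mem_inf hA (mem_principal.mpr ht)
      exact h2.ne (empty_mem_iff_bot.mp h3)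
    · intro β
      exact mem_inf_of_right (mem_iInf_of_mem β (mem_principal_self _))
    · intro b k hb hk
      have hfin : (⋃ n ∈ Set.Iio k, {s : SS | ∀ β ∈ b, s ∈ LL i β n}).Finite :=
        (Set.finite_Iio k).biUnion fun n hn => LL_linked i b n (lt_of_lt_of_le hn hk)
      refine hfin.subset ?_
      rintro x ⟨hx, hxk⟩
      simp only [Set.mem_iInter] at hx
      obtain ⟨β, hβ⟩ := hb
      have h0 := (hx β hβ).1
      have hex : ∃ m, x ∉ C m := ⟨k, hxk⟩
      have hm := Nat.find_spec hex
      have hmk : Nat.find hex ≤ k := Nat.find_min' hex hxk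
      obtain ⟨n, hn⟩ : ∃ n, Nat.find hex = n + 1 := by
        refine Nat.exists_eq_succ_of_ne_zero fun h0' => ?_
        rw [h0'] at hm
        exact hm h0
      rw [hn] at hm hmk
      have hxn : x ∈ C n := by
        by_contra hcon
        have := Nat.find_min' hex hcon
        omega
      simp only [Set.mem_iUnion]
      exact ⟨n, by simpa using hmk, fun β hβ => (hx β hβ).2 n hxn hm⟩

lemma stepB {F : Filter SS} {R : Set Row} (h : Good F R) (hR : ∃ i, i ∉ R)
    (r : Ultrafilter SS) :
    ∃ (F' : Filter SS) (U : Finset Row), F' ≤ F ∧ Good F' (R ∪ U) ∧ TaskB r F' := by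
  classical
  obtain ⟨i, hi⟩ := hR
  have hex : ∃ β, (r : Filter SS) ≤ cofinite → LL i β 1 ∉ r := by
    by_contra! hcon
    let β : Row := fun _ => true
    let γ : Row := fun _ => false
    have hne : β ≠ γ := fun e => by simpa [β, γ] using congrFun e 0
    have hfin := LL_linked i {β, γ} 1 (by rw [Finset.card_pair hne]; norm_num)
    have h1 := inter_mem (hcon β).2 (hcon γ).2
    have h2 := (hcon β).1 hfin.compl_mem_cofinite
    have h3 := inter_mem h1 h2
    obtain ⟨s, ⟨hs1, hs2⟩, hs3⟩ := Ultrafilter.nonempty_of_mem h3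
    apply hs3
    intro δ hδ
    rcases Finset.mem_insert.mp hδ with rfl | hδ
    · exact hs1
    · rw [Finset.mem_singleton.mp hδ]; exact hs2
  obtain ⟨β, hβ⟩ := hex
  refine ⟨F ⊓ 𝓟 (PP {i} (fun _ => {β})), {i}, inf_le_left, good_inf h _ _ (by simpa using hi), ?_⟩
  intro hr
  refine ⟨_, mem_inf_of_right (mem_principal_self _), ?_⟩
  have : PP {i} (fun _ => {β}) = LL i β 1 := by
    ext s; simp [PP]
  rw [this]
  exact hβ hr

abbrev TT : Type := (Cardinal.continuum.{0}).ord.ToType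

lemma exists_row {R : Set Row} (hR : #R < 𝔠) : ∃ i, i ∉ R := by
  by_contra! h
  have : R = Set.univ := Set.eq_univ_of_forall h
  rw [this, mk_univ] at hR
  simp at hR

lemma step {F : Filter SS} {R : Set Row} (h : Good F R) (hR : #R < 𝔠)
    (C : ℕ → Set SS) (hC : Antitone C) (r : Ultrafilter SS) :
    ∃ (F' : Filter SS) (U : Finset Row), F' ≤ F ∧ Good F' (R ∪ U) ∧ TaskA C F' ∧ TaskB r F' := by
  classical
  obtain ⟨F1, U1, hF1, hG1, hT1⟩ := stepA h (exists_row hR) C hC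
  have hR1 : #(R ∪ U1 : Set Row) < 𝔠 := by
    refine (mk_union_le _ _).trans_lt (add_lt_of_lt aleph0_le_continuum hR ?_)
    exact (U1.finite_toSet.lt_aleph0).trans aleph0_lt_continuum
  obtain ⟨F2, U2, hF2, hG2, hT2⟩ := stepB hG1 (exists_row hR1) r
  refine ⟨F2, U1 ∪ U2, hF2.trans hF1, ?_, hT1.mono hF2, hT2⟩
  rwa [Finset.coe_union, ← Set.union_assoc]

lemma construct (C : TT → ℕ → Set SS) (hC : ∀ t, Antitone (C t))
    (r : TT → Ultrafilter SS) :
    ∃ q : Ultrafilter SS, (q : Filter SS) ≤ cofinite ∧ ∀ t, TaskA (C t) q ∧ TaskB (r t) q := by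
  classical
  have hstep : ∀ (t : TT) (F : Filter SS) (R : Set Row),
      ∃ (F' : Filter SS) (U : Finset Row), F' ≤ F ∧ (Good F R → #R < 𝔠 →
        Good F' (R ∪ U) ∧ TaskA (C t) F' ∧ TaskB (r t) F') := by
    intro t F R
    by_cases h : Good F R ∧ #R < 𝔠
    · obtain ⟨F', U, h1, h2⟩ := step h.1 h.2 (C t) (hC t) (r t)
      exact ⟨F', U, h1, fun _ _ => h2⟩
    · exact ⟨F, ∅, le_rfl, fun h1 h2 => absurd ⟨h1, h2⟩ h⟩
  choose nF nU hle hgood using hstep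
  obtain ⟨f, hf⟩ : ∃ f : TT → Filter SS × Finset Row, ∀ t,
      f t = (nF t (cofinite ⊓ ⨅ s, ⨅ (_ : s < t), (f s).1) (⋃ s, ⋃ (_ : s < t), ((f s).2 : Set Row)),
        nU t (cofinite ⊓ ⨅ s, ⨅ (_ : s < t), (f s).1) (⋃ s, ⋃ (_ : s < t), ((f s).2 : Set Row))) := by
    let G : (t : TT) → ((s : TT) → s < t → Filter SS × Finset Row) →
        Filter SS × Finset Row := fun t rec =>
      (nF t (cofinite ⊓ ⨅ s, ⨅ (h : s < t), (rec s h).1) (⋃ s, ⋃ (h : s < t), ((rec s h).2 : Set Row)),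
        nU t (cofinite ⊓ ⨅ s, ⨅ (h : s < t), (rec s h).1) (⋃ s, ⋃ (h : s < t), ((rec s h).2 : Set Row)))
    exact ⟨wellFounded_lt.fix G, fun t => WellFounded.fix_eq _ G t⟩
  set inF : TT → Filter SS := fun t => cofinite ⊓ ⨅ s, ⨅ (_ : s < t), (f s).1 with hinF
  set inR : TT → Set Row := fun t => ⋃ s, ⋃ (_ : s < t), ((f s).2 : Set Row) with hinR
  have hf1 : ∀ t, (f t).1 = nF t (inF t) (inR t) := fun t => by rw [hf t]
  have hf2 : ∀ t, (f t).2 = nU t (inF t) (inR t) := fun t => by rw [hf t]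
  have hfle : ∀ t, (f t).1 ≤ inF t := fun t => by rw [hf1]; exact hle _ _ _
  have hfcof : ∀ t, (f t).1 ≤ cofinite := fun t => (hfle t).trans inf_le_left
  have hmono : ∀ s t, s < t → (f t).1 ≤ (f s).1 := fun s t hst =>
    (hfle t).trans (inf_le_right.trans (iInf₂_le s hst))
  have hanti : ∀ s t, s ≤ t → (f t).1 ≤ (f s).1 := fun s t hst => by
    rcases hst.lt_or_eq with h | rfl
    · exact hmono _ _ h
    · exact le_rfl
  have hcard : ∀ t, #(inR t) < 𝔠 := by
    intro t
    have hsub : inR t ⊆ ⋃ s : Set.Iio t, ((f s).2 : Set Row) := by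
      intro i hi
      simp only [hinR, Set.mem_iUnion] at hi ⊢
      obtain ⟨s, hs, h⟩ := hi
      exact ⟨⟨s, hs⟩, h⟩
    refine (mk_le_mk_of_subset hsub).trans_lt ?_
    refine (mk_iUnion_le_sum_mk).trans_lt ?_
    have : (Cardinal.sum fun s : Set.Iio t => #(((f s).2 : Set Row))) ≤
        Cardinal.sum fun _ : Set.Iio t => ℵ₀ :=
      Cardinal.sum_le_sum _ _ fun s => ((f s).2.finite_toSet.lt_aleph0).le
    refine this.trans_lt ?_
    rw [sum_const']
    exact mul_lt_of_lt aleph0_le_continuum (mk_Iio_toType_ord_lt t) aleph0_lt_continuum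
  have hinv : ∀ t, Good (f t).1 (inR t ∪ ((f t).2 : Set Row)) ∧ TaskA (C t) (f t).1 ∧
      TaskB (r t) (f t).1 := by
    intro t
    induction t using WellFoundedLT.induction with
    | ind t ih =>
    have hG : Good (inF t) (inR t) := by
      intro a b hab
      by_cases hne : (Set.Iio t).Nonempty
      · have heq : inF t = ⨅ s ∈ Set.Iio t, (f s).1 := by
          refine le_antisymm inf_le_right (le_inf ?_ le_rfl)
          obtain ⟨s, hs⟩ := hne
          exact (iInf₂_le s hs).trans (hfcof s)
        rw [neBot_iff]
        intro hbot
        rw [inf_principal_eq_bot, heq, mem_biInf_of_directed _ hne] at hbot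
        · obtain ⟨s, hs, hA⟩ := hbot
          have := (ih s hs).1 a b (by
            refine hab.mono_right ?_
            intro i hi
            simp only [hinR, Set.mem_iUnion, Set.mem_union] at hi ⊢
            rcases hi with ⟨s', hs', hi⟩ | hi
            · exact ⟨s', hs'.trans hs, hi⟩
            · exact ⟨s, hs, hi⟩)
          exact this.ne (inf_principal_eq_bot.mpr hA)
        · intro s hs s' hs'
          rcases le_total s s' with h | h
          · exact ⟨s', hs', hanti _ _ h, le_rfl⟩
          · exact ⟨s, hs, le_rfl, hanti _ _ h⟩
      · have heq : inF t = cofinite := by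
          refine le_antisymm inf_le_left (le_inf le_rfl ?_)
          refine le_iInf₂ fun s hs => absurd ⟨s, hs⟩ hne
        rw [heq]
        exact good_cofinite a b (Set.disjoint_empty _)
    have := hgood t _ _ hG (hcard t)
    rw [← hf1, ← hf2] at this
    exact this
  have hne : Nonempty TT := by
    rw [← mk_ne_zero_iff, mk_ord_toType]
    exact continuum_ne_zero
  have hdir : Directed (· ≥ ·) fun t => (f t).1 := by
    intro s s'
    rcases le_total s s' with h | h
    · exact ⟨s', hanti _ _ h, le_rfl⟩
    · exact ⟨s, le_rfl, hanti _ _ h⟩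
  have hnb : (⨅ t, (f t).1).NeBot := by
    have : Nonempty SS := ⟨⟨0, fun _ => ∅⟩⟩
    rw [iInf_neBot_iff_of_directed hdir]
    intro t
    exact ((hinv t).1 ∅ (fun _ => ∅) (by simp)).mono inf_le_left
  let q := Ultrafilter.of (⨅ t, (f t).1)
  have hq : ∀ t, (q : Filter SS) ≤ (f t).1 := fun t => (Ultrafilter.of_le _).trans (iInf_le _ t)
  exact ⟨q, (hq (Classical.arbitrary _)).trans (hfcof _), fun t =>
    ⟨(hinv t).2.1.mono (hq t), (hinv t).2.2.mono (hq t)⟩⟩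

instance : Infinite SS :=
  Infinite.of_surjective (Sigma.fst : SS → ℕ) fun k => ⟨⟨k, fun _ => ∅⟩, rfl⟩

/-- Kunen: there is a weak P-point which is not Rudin-Keisler below `p`. -/
theorem exists_weakP (p : Ultrafilter ℕ) :
    ∃ q : Ultrafilter SS, (q : Filter SS) ≤ cofinite ∧ (∀ f : ℕ → SS, p.map f ≠ q) ∧
      ∀ c : ℕ → Ultrafilter SS, ∃ V ∈ q, ∀ n, (c n : Filter SS) ≤ cofinite → c n ≠ q → V ∉ c n := by
  classical
  have hcard : #((ℕ → Set SS) × (ℕ → SS)) = #(TT) := by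
    rw [mk_ord_toType]; simp
  obtain ⟨e⟩ := Cardinal.eq.mp hcard.symm
  obtain ⟨q, hq, hT⟩ := construct (fun t n => ⋂ m ≤ n, (e t).1 m)
    (fun t m n hmn x hx => by
      simp only [Set.mem_iInter] at hx ⊢
      exact fun k hk => hx k (hk.trans hmn)) (fun t => p.map (e t).2)
  refine ⟨q, hq, ?_, ?_⟩
  · intro f hf
    obtain ⟨t, ht⟩ := e.surjective (fun _ => ∅, f)
    have h1 := (hT t).2
    simp only [ht, hf] at h1
    obtain ⟨A, hA, hA'⟩ := h1 hq
    exact hA' hA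
  · intro c
    have hA : ∀ n, ∃ A ∈ q, (c n ≠ q → A ∉ c n) := by
      intro n
      by_cases h : c n = q
      · exact ⟨Set.univ, univ_mem, fun h' => absurd h h'⟩
      · by_contra! hcon
        apply h
        have : (c n : Filter SS) ≤ q := fun A hA => (hcon A hA).2
        exact Ultrafilter.coe_le_coe.mp this
    choose A hAq hAc using hA
    obtain ⟨t, ht⟩ := e.surjective (A, fun _ => ⟨0, fun _ => ∅⟩)
    have h1 := (hT t).1
    simp only [ht] at h1
    rcases h1 with ⟨n, hn⟩ | ⟨V, hV, hV'⟩
    · exfalso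
      have : (⋂ m ≤ n, A m) ∈ q :=
        (biInter_mem (Set.finite_Iic n)).mpr fun m _ => hAq m
      exact Ultrafilter.compl_notMem_iff.mpr this hn
    · have hcount : ∀ n, {β | (c n : Filter SS) ≤ cofinite ∧ c n ≠ q ∧ V β ∈ c n}.Finite := by
        intro n
        by_contra hinf
        obtain ⟨b, hb, hbc⟩ := Set.Infinite.exists_subset_card_eq hinf (n + 1)
        have hbne : b.Nonempty := Finset.card_pos.mp (by omega)
        obtain ⟨β, hβ⟩ := hbne
        have hfin := hV' b n ⟨β, hβ⟩ (by omega)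
        obtain ⟨hc1, hc2, _⟩ := hb hβ
        have h2 : (⋂ β ∈ b, V β) ∈ c n :=
          (biInter_finset_mem b).mpr fun γ hγ => (hb hγ).2.2
        have h3 := inter_mem h2 (hc1 hfin.compl_mem_cofinite)
        refine hAc n hc2 (mem_of_superset h3 ?_)
        rintro x ⟨hx, hx'⟩
        by_contra hxn
        refine hx' ⟨hx, fun h => hxn ?_⟩
        simp only [Set.mem_iInter] at h
        exact h n le_rfl
      have hcc := Set.countable_iUnion fun n => (hcount n).countable
      obtain ⟨β, hβ⟩ : ∃ β, β ∉ ⋃ n, {β | (c n : Filter SS) ≤ cofinite ∧ c n ≠ q ∧ V β ∈ c n} := by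
        apply exists_row
        exact (le_aleph0_iff_set_countable.mpr hcc).trans_lt aleph0_lt_continuum
      refine ⟨V β, hV β, fun n h1 h2 h3 => hβ (Set.mem_iUnion.mpr ⟨n, h1, h2, h3⟩)⟩

section Topo
variable {X : Type*} [TopologicalSpace X]

lemma discrete_of {A : Set X} (h : ∀ a ∈ A, a ∉ closure (A \ {a})) : DiscreteTopology ↥A := by
  rw [discreteTopology_subtype_iff]
  intro a ha
  have h1 := h a ha
  rw [mem_closure_iff_nhdsWithin_neBot, not_neBot] at h1
  rw [nhdsWithin, inf_assoc, inf_principal]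
  rw [nhdsWithin] at h1
  have h2 : {a}ᶜ ∩ A = A \ {a} := by rw [Set.inter_comm]; rfl
  rw [h2]
  exact h1

lemma no_conv [T2Space X] (hX : IsR2Space X) {w : ℕ → X} {x : X}
    (hw : Tendsto w atTop (𝓝 x)) (hne : ∀ n, w n ≠ x) : False := by
  set D := Set.range w with hD
  have hxD : x ∉ D := by rintro ⟨n, hn⟩; exact hne n hn
  have hnear : ∀ O ∈ 𝓝 x, (D \ O).Finite := by
    intro O hO
    obtain ⟨N, hN⟩ := eventually_atTop.mp (hw hO)
    refine ((Set.finite_Iio N).image w).subset ?_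
    rintro _ ⟨⟨n, rfl⟩, hn⟩
    refine ⟨n, ?_, rfl⟩
    by_contra h
    exact hn (hN n (not_lt.mp h))
  have hinf : D.Infinite := by
    intro hfin
    have h1 : Dᶜ ∈ 𝓝 x := hfin.isClosed.isOpen_compl.mem_nhds hxD
    have h2 : ∀ᶠ n in atTop, w n ∈ Dᶜ := hw h1
    obtain ⟨n, hn⟩ := h2.exists
    exact hn ⟨n, rfl⟩
  have hcl : ∀ J ⊆ D, ∀ z, z ≠ x → z ∉ J → z ∉ closure J := by
    intro J hJ z hzx hzJ hz
    obtain ⟨O, O', hO, hO', hzO, hxO', hdis⟩ := t2_separation hzx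
    have hfin : (J \ O').Finite := (hnear O' (hO'.mem_nhds hxO')).subset
      (Set.sdiff_subset_sdiff_left hJ)
    have hz2 : O ∩ (J \ O')ᶜ ∈ 𝓝 z := by
      refine inter_mem (hO.mem_nhds hzO) (hfin.isClosed.isOpen_compl.mem_nhds ?_)
      exact fun h => hzJ h.1
    obtain ⟨y, ⟨hyO, hyn⟩, hyJ⟩ := mem_closure_iff_nhds.mp hz _ hz2
    exact hyn ⟨hyJ, fun h => Set.disjoint_left.mp hdis hyO h⟩
  have hclx : ∀ J ⊆ D, J.Infinite → x ∈ closure J := by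
    intro J hJ hJi
    rw [mem_closure_iff_nhds]
    intro O hO
    by_contra h
    refine hJi ((hnear O hO).subset fun y hy => ⟨hJ hy, fun hyO => h ⟨y, hyO, hy⟩⟩)
  obtain ⟨A, B, hAB, hdis, hc⟩ := hinf.exists_union_disjoint_cardinal_eq_of_infinite
  have hAD : A ⊆ D := hAB ▸ Set.subset_union_left
  have hBD : B ⊆ D := hAB ▸ Set.subset_union_right
  have hAiff : A.Finite ↔ B.Finite := by
    rw [← lt_aleph0_iff_set_finite, ← lt_aleph0_iff_set_finite, hc]
  have hAi : A.Infinite := fun h => hinf (hAB ▸ h.union (hAiff.mp h))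
  have hBi : B.Infinite := fun h => hinf (hAB ▸ (hAiff.mpr h).union h)
  have hDc : D.Countable := Set.countable_range w
  have hcl2 : closure A ∩ closure B = ∅ := by
    apply hX A B (hDc.mono hAD) (hDc.mono hBD)
    · apply discrete_of
      intro a ha
      exact hcl _ (Set.sdiff_subset.trans hAD) a (fun h => hxD (h ▸ hAD ha)) (fun h => h.2 rfl)
    · rw [Set.eq_empty_iff_forall_notMem]
      rintro z ⟨hzA, hzB⟩
      exact hcl A hAD z (fun h => hxD (h ▸ hBD hzB)) (fun h => Set.disjoint_left.mp hdis h hzB) hzA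
    · rw [Set.eq_empty_iff_forall_notMem]
      rintro z ⟨hzA, hzB⟩
      exact hcl B hBD z (fun h => hxD (h ▸ hAD hzA)) (fun h => Set.disjoint_left.mp hdis hzA h) hzB
  have : x ∈ closure A ∩ closure B := ⟨hclx A hAD hAi, hclx B hBD hBi⟩
  rw [hcl2] at this
  exact this

lemma ultra_tendsto [CompactSpace X] {S : Type*} (q : Ultrafilter S) (e : S → X) :
    ∃ y, Tendsto e q (𝓝 y) := by
  obtain ⟨y, _, hy⟩ := isCompact_iff_ultrafilter_le_nhds.mp (isCompact_univ (X := X)) (q.map e)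
    (by simp)
  exact ⟨y, hy⟩

/-- A point which is only trivially a limit along `p`. -/
lemma good_point [CompactSpace X] [T2Space X] [Infinite X] (hX : IsR2Space X)
    (p : Ultrafilter ℕ) :
    ∃ y : X, ∀ c : ℕ → X, Tendsto c p (𝓝 y) → ∀ᶠ n in (p : Filter ℕ), c n = y := by
  classical
  obtain ⟨q, hqc, hqp, hqw⟩ := exists_weakP p
  obtain ⟨U0, hU0i, hU0o, hU0d⟩ := exists_seq_infinite_isOpen_pairwise_disjoint X
  obtain ⟨g, hg⟩ := Countable.exists_injective_nat SS
  let U : SS → Set X := fun s => U0 (g s)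
  have hUo : ∀ s, IsOpen (U s) := fun s => hU0o _
  have hUd : ∀ s t x, x ∈ U s → x ∈ U t → s = t := by
    intro s t x hs ht
    by_contra hne
    exact Set.disjoint_left.mp (hU0d (fun h => hne (hg h))) hs ht
  have hUe : ∀ s, ∃ x, x ∈ U s := fun s => (hU0i (g s)).nonempty
  choose e he using hUe
  -- separation of pieces
  have hsep : ∀ (A : Set SS) (B : Set X), B.Countable → closure (e '' A) ∩ B = ∅ →
      (∀ s ∈ A, ∀ b ∈ B, b ∉ U s) → closure (e '' A) ∩ closure B = ∅ := by
    intro A B hB h1 h2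
    refine hX _ _ (A.to_countable.image e) hB ?_ h1 ?_
    · apply discrete_of
      rintro _ ⟨s, hs, rfl⟩ hcl
      obtain ⟨_, hx, ⟨t, ht, rfl⟩, hts⟩ := mem_closure_iff.mp hcl _ (hUo s) (he s)
      apply hts
      rw [hUd s t _ hx (he t)]; rfl
    · rw [Set.eq_empty_iff_forall_notMem]
      rintro _ ⟨⟨s, hs, rfl⟩, hcl⟩
      obtain ⟨b, hb, hbB⟩ := mem_closure_iff.mp hcl _ (hUo s) (he s)
      exact h2 s hs b hbB hb
  obtain ⟨y, hy⟩ := ultra_tendsto q e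
  have hyA : ∀ A ∈ q, y ∈ closure (e '' A) := fun A hA =>
    mem_closure_of_tendsto hy (mem_of_superset (show A ∈ (q : Filter SS) from hA)
      fun s hs => Set.mem_image_of_mem e hs)
  refine ⟨y, fun c hc => ?_⟩
  have hyc : ∀ P ∈ p, y ∈ closure (c '' P) := fun P hP =>
    mem_closure_of_tendsto hc (mem_of_superset (show P ∈ (p : Filter ℕ) from hP)
      fun s hs => Set.mem_image_of_mem c hs)
  have hcount : ∀ P : Set ℕ, (c '' P).Countable := fun P => P.to_countable.image c
  have contra : ∀ A ∈ q, ∀ P ∈ p, closure (e '' A) ∩ closure (c '' P) = ∅ → False := by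
    intro A hA P hP h
    have : y ∈ closure (e '' A) ∩ closure (c '' P) := ⟨hyA A hA, hyc P hP⟩
    rw [h] at this
    exact this
  by_contra hcon
  have hP0 : {n | c n ≠ y} ∈ p := by
    rw [← Ultrafilter.eventually_not] at hcon
    exact hcon
  by_cases hcase : {n | ∃ s, c n ∈ U s} ∈ p
  · let f : ℕ → SS := fun n => if h : ∃ s, c n ∈ U s then h.choose else Classical.arbitrary SS
    have hf : ∀ n, (∃ s, c n ∈ U s) → c n ∈ U (f n) := by
      intro n h
      simp only [f, dif_pos h]
      exact h.choose_spec
    apply hqp f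
    symm
    apply Ultrafilter.coe_le_coe.mp
    intro A hA
    by_contra hAq
    have hAq' : Aᶜ ∈ q := Ultrafilter.compl_mem_iff_notMem.mpr hAq
    have hPm : {n | ∃ s, c n ∈ U s} ∩ f ⁻¹' A ∈ p := inter_mem hcase hA
    refine contra _ hAq' _ hPm (hsep _ _ (hcount _) ?_ ?_)
    · rw [Set.eq_empty_iff_forall_notMem]
      rintro _ ⟨hcl, n, ⟨hn, hnA⟩, rfl⟩
      obtain ⟨_, hx, t, ht, rfl⟩ := mem_closure_iff.mp hcl _ (hUo (f n)) (hf n hn)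
      apply ht
      rw [← hUd _ _ _ hx (he t)]
      exact hnA
    · rintro s hs _ ⟨n, ⟨hn, hnA⟩, rfl⟩ hU
      apply hs
      rw [hUd _ _ _ hU (hf n hn)]
      exact hnA
  · have hcase' : {n | ∃ s, c n ∈ U s}ᶜ ∈ p := Ultrafilter.compl_mem_iff_notMem.mpr hcase
    by_cases hcase2 : {n | c n ∈ closure (Set.range e)} ∈ p
    · have hu : ∀ n, ∃ u : Ultrafilter SS, c n ∈ closure (Set.range e) → Tendsto e u (𝓝 (c n)) := by
        intro n
        by_cases h : c n ∈ closure (Set.range e)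
        · obtain ⟨v, hv1, hv2⟩ := mem_closure_iff_ultrafilter.mp h
          rw [← Set.image_univ] at hv1
          refine ⟨Ultrafilter.ofComapInfPrincipal hv1, fun _ => ?_⟩
          have h3 := Ultrafilter.ofComapInfPrincipal_eq_of_map hv1
          have h4 : Filter.map e (Ultrafilter.ofComapInfPrincipal hv1 : Filter SS) = v := by
            rw [← Ultrafilter.coe_map, h3]
          rw [Tendsto, h4]
          exact hv2
        · exact ⟨q, fun h' => absurd h' h⟩
      choose u hu using hu
      obtain ⟨V, hV, hVu⟩ := hqw u
      have hPm := inter_mem (inter_mem hP0 hcase') hcase2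
      refine contra V hV _ hPm ?_
      have hVV : closure (e '' V) ∩ closure (e '' Vᶜ) = ∅ := by
        apply hsep _ _ ((Vᶜ).to_countable.image e)
        · rw [Set.eq_empty_iff_forall_notMem]
          rintro _ ⟨hcl, s, hs, rfl⟩
          obtain ⟨_, hx, t, ht, rfl⟩ := mem_closure_iff.mp hcl _ (hUo s) (he s)
          apply hs
          rw [hUd _ _ _ hx (he t)]
          exact ht
        · rintro s hs _ ⟨t, ht, rfl⟩ hU
          apply ht
          rw [← hUd _ _ _ hU (he t)]
          exact hs
      have hsub : c '' ({n | c n ≠ y} ∩ {n | ∃ s, c n ∈ U s}ᶜ ∩ {n | c n ∈ closure (Set.range e)})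
          ⊆ closure (e '' Vᶜ) := by
        rintro _ ⟨n, ⟨⟨hn1, hn2⟩, hn3⟩, rfl⟩
        have ht := hu n hn3
        have hVC : Vᶜ ∈ u n := by
          refine Ultrafilter.compl_mem_iff_notMem.mpr (hVu n ?_ ?_)
          · rcases (u n).le_cofinite_or_eq_pure with h | ⟨s, hs⟩
            · exact h
            · exfalso
              rw [hs] at ht
              have h1 : c n = e s := tendsto_nhds_unique ht (by
                simpa using tendsto_pure_nhds e s)
              exact hn2 ⟨s, h1 ▸ he s⟩
          · intro h
            rw [h] at ht
            exact hn1 (tendsto_nhds_unique ht hy)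
        exact mem_closure_of_tendsto ht (mem_of_superset
          (show Vᶜ ∈ (u n : Filter SS) from hVC) fun s hs => Set.mem_image_of_mem e hs)
      rw [Set.eq_empty_iff_forall_notMem] at hVV ⊢
      rintro z ⟨hz1, hz2⟩
      exact hVV z ⟨hz1, closure_minimal hsub isClosed_closure hz2⟩
    · have hcase2' := Ultrafilter.compl_mem_iff_notMem.mpr hcase2
      refine contra Set.univ univ_mem _ (inter_mem hcase' hcase2') (hsep _ _ (hcount _) ?_ ?_)
      · rw [Set.eq_empty_iff_forall_notMem]
        rintro _ ⟨hcl, n, ⟨hn, hn2⟩, rfl⟩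
        rw [Set.image_univ] at hcl
        exact hn2 hcl
      · rintro s _ _ ⟨n, ⟨hn, hn2⟩, rfl⟩ hU
        exact hn ⟨s, hU⟩

end Topo

end R2Prod

open R2Prod Filter Topology in
/-- No product of infinite compact Hausdorff R₂-spaces is homogeneous. -/
theorem no_homogeneous_product_of_R2 (ι : Type*) [Nonempty ι]
    (X : ι → Type*) [∀ i, TopologicalSpace (X i)] [∀ i, CompactSpace (X i)]
    [∀ i, T2Space (X i)] [∀ i, Infinite (X i)]
    (hX : ∀ i, IsR2Space (X i)) :
    ¬ IsHomogeneousSpace (∀ i, X i) := by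
  classical
  intro hom
  let p : Ultrafilter ℕ := hyperfilter ℕ
  have hpc : (p : Filter ℕ) ≤ cofinite := hyperfilter_le_cofinite
  let i₀ : ι := Classical.arbitrary ι
  obtain ⟨U, hUi, hUo, hUd⟩ := exists_seq_infinite_isOpen_pairwise_disjoint (X i₀)
  choose d hd using fun n => (hUi n).nonempty
  obtain ⟨x0, hx0⟩ := ultra_tendsto p d
  have hx0U : ∀ n, x0 ∉ U n := by
    intro n hn
    have h1 : ∀ᶠ m in (p : Filter ℕ), d m ∈ U n := hx0 ((hUo n).mem_nhds hn)
    have h2 : ∀ᶠ m in (p : Filter ℕ), m ≠ n :=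
      hpc (Set.finite_singleton n).compl_mem_cofinite
    obtain ⟨m, hm1, hm2⟩ := (h1.and h2).exists
    exact Set.disjoint_left.mp (hUd hm2) (hd m) hm1
  choose y hy using fun i => good_point (hX i) p
  let x : ∀ i, X i := Function.update y i₀ x0
  obtain ⟨h, hh⟩ := hom y x
  let D : ℕ → ∀ i, X i := fun n => Function.update x i₀ (d n)
  have hD : Tendsto D p (𝓝 x) := by
    have : Tendsto D p (𝓝 (Function.update x i₀ x0)) :=
      tendsto_const_nhds.update i₀ hx0
    simpa [x] using this
  have hhD : Tendsto (fun n => h (D n)) p (𝓝 y) := by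
    have := (h.continuous.tendsto x).comp hD
    rwa [hh] at this
  have hcoord : ∀ i, ∀ᶠ n in (p : Filter ℕ), h (D n) i = y i := fun i =>
    hy i _ (tendsto_pi_nhds.mp hhD i)
  let k : (∀ i, X i) → X i₀ := fun z => h.symm z i₀
  have hk : Continuous k := (continuous_apply i₀).comp h.symm.continuous
  have hky : k y = x0 := by
    have h1 : h.symm y = x := by rw [← hh, h.symm_apply_apply]
    simp only [k, h1, x, Function.update_self]
  have hkD : ∀ n, h (D n) ∈ k ⁻¹' (U n) := by
    intro n
    simp only [Set.mem_preimage, k, h.symm_apply_apply, D, Function.update_self]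
    exact hd n
  have hbox := fun n => isOpen_pi_iff.mp ((hUo n).preimage hk) _ (hkD n)
  choose S u hSu hSsub using hbox
  let z : ℕ → ∀ i, X i := fun n i => if i ∈ S n then h (D n) i else y i
  have hz : ∀ n, k (z n) ∈ U n := by
    intro n
    apply hSsub n
    intro i hi
    have hi' : i ∈ S n := hi
    simp only [z, hi', if_true]
    exact (hSu n i hi').2
  have hzc : ∀ i, ∀ᶠ n in (p : Filter ℕ), z n i = y i := by
    intro i
    filter_upwards [hcoord i] with n hn
    simp only [z, hn, ite_self]
  have hJ : (⋃ n, (S n : Set ι)).Countable :=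
    Set.countable_iUnion fun n => (S n).countable_toSet
  obtain ⟨σ, hσ⟩ := Set.countable_iff_exists_subset_range.mp hJ
  have hN : ∀ N : ℕ, ∃ n, ∀ m ∈ Finset.range N, z n (σ m) = y (σ m) := by
    intro N
    exact ((eventually_all_finset (Finset.range N)).mpr fun m _ => hzc (σ m)).exists
  choose ν hν using hN
  have hw : Tendsto (fun N => z (ν N)) atTop (𝓝 y) := by
    rw [tendsto_pi_nhds]
    intro i
    refine tendsto_const_nhds.congr' ?_
    by_cases hi : i ∈ ⋃ n, (S n : Set ι)
    · obtain ⟨m, rfl⟩ := hσ hi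
      filter_upwards [eventually_gt_atTop m] with N hN
      exact (hν N m (Finset.mem_range.mpr hN)).symm
    · refine Eventually.of_forall fun N => ?_
      have : i ∉ S (ν N) := fun h' => hi (Set.mem_iUnion.mpr ⟨_, h'⟩)
      simp only [z, this, if_false]
  have hkw : Tendsto (fun N => k (z (ν N))) atTop (𝓝 x0) := by
    have := (hk.tendsto y).comp hw
    rwa [hky] at this
  exact no_conv (hX i₀) hkw fun N hN => hx0U (ν N) (hN ▸ hz (ν N))
end
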